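/- There exists a type-1 configuration of [3,1,1] whose contact graph admits no proper 3-coloring. -/

import Mathlib

/-- A cuboid with integer root and integer dimensions. -/
structure Cuboid where
  root : ℤ × ℤ × ℤ
  dims : ℤ × ℤ × ℤ
deriving DecidableEq

namespace Cuboid

/-- The dimensions are positive. -/
def valid (C : Cuboid) : Prop :=
  0 < C.dims.1 ∧ 0 < C.dims.2.1 ∧ 0 < C.dims.2.2

/-- The closed cuboid `[x,x+a] × [y,y+b] × [z,z+c] ⊆ ℝ³`. -/
def toSet (C : Cuboid) : Set (ℝ × ℝ × ℝ) :=
  {p | (C.root.1 : ℝ) ≤ p.1 ∧ p.1 ≤ C.root.1 + C.dims.1 ∧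
       (C.root.2.1 : ℝ) ≤ p.2.1 ∧ p.2.1 ≤ C.root.2.1 + C.dims.2.1 ∧
       (C.root.2.2 : ℝ) ≤ p.2.2 ∧ p.2.2 ≤ C.root.2.2 + C.dims.2.2}

/-- The open cuboid `(x,x+a) × (y,y+b) × (z,z+c) ⊆ ℝ³` (the interior). -/
def inte (C : Cuboid) : Set (ℝ × ℝ × ℝ) :=
  {p | (C.root.1 : ℝ) < p.1 ∧ p.1 < C.root.1 + C.dims.1 ∧
       (C.root.2.1 : ℝ) < p.2.1 ∧ p.2.1 < C.root.2.1 + C.dims.2.1 ∧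
       (C.root.2.2 : ℝ) < p.2.2 ∧ p.2.2 < C.root.2.2 + C.dims.2.2}

/-- The set `(ℤ×ℤ×ℝ) ∪ (ℤ×ℝ×ℤ) ∪ (ℝ×ℤ×ℤ)` of grid lines. -/
def grid : Set (ℝ × ℝ × ℝ) :=
  {p | ((∃ m : ℤ, p.1 = m) ∧ (∃ n : ℤ, p.2.1 = n)) ∨
       ((∃ m : ℤ, p.1 = m) ∧ (∃ n : ℤ, p.2.2 = n)) ∨
       ((∃ m : ℤ, p.2.1 = m) ∧ (∃ n : ℤ, p.2.2 = n))}

/-- Two cuboids collide when their interiors intersect. -/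
def Collide (C D : Cuboid) : Prop := (C.inte ∩ D.inte).Nonempty

/-- Two cuboids touch when their interiors are disjoint but their intersection
contains a point outside the grid lines (i.e. it is a non-degenerate rectangle). -/
def Touch (C D : Cuboid) : Prop :=
  ¬ Collide C D ∧ ∃ p ∈ C.toSet ∩ D.toSet, p ∉ grid

end Cuboid

/-- A configuration: a finite family of valid pairwise non-colliding cuboids. -/
def IsConfig (F : Finset Cuboid) : Prop :=
  (∀ C ∈ F, C.valid) ∧ ∀ C ∈ F, ∀ D ∈ F, C ≠ D → ¬ Cuboid.Collide C D

/-- A type-1 configuration of `[a,b,c]`: every cuboid has dimensions exactly `(a,b,c)`. -/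
def Type1 (a b c : ℕ) (F : Finset Cuboid) : Prop :=
  ∀ C ∈ F, C.dims = ((a : ℤ), (b : ℤ), (c : ℤ))

/-- A type-2 configuration of `[a,b,c]`: every cuboid has dimensions `(a,b,c)` or `(b,a,c)`. -/
def Type2 (a b c : ℕ) (F : Finset Cuboid) : Prop :=
  ∀ C ∈ F, C.dims = ((a : ℤ), (b : ℤ), (c : ℤ)) ∨ C.dims = ((b : ℤ), (a : ℤ), (c : ℤ))

/-- A type-3 configuration of `[a,b,c]`: every cuboid's dimensions are a permutation of `(a,b,c)`. -/
def Type3 (a b c : ℕ) (F : Finset Cuboid) : Prop :=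
  ∀ C ∈ F, C.dims = ((a : ℤ), (b : ℤ), (c : ℤ)) ∨ C.dims = ((a : ℤ), (c : ℤ), (b : ℤ)) ∨
    C.dims = ((b : ℤ), (a : ℤ), (c : ℤ)) ∨ C.dims = ((b : ℤ), (c : ℤ), (a : ℤ)) ∨
    C.dims = ((c : ℤ), (a : ℤ), (b : ℤ)) ∨ C.dims = ((c : ℤ), (b : ℤ), (a : ℤ))

/-- A proper `k`-coloring of a configuration: touching cuboids get distinct colors. -/
def ProperColoring (k : ℕ) (F : Finset Cuboid) : Prop :=
  ∃ κ : Cuboid → Fin k, ∀ C ∈ F, ∀ D ∈ F, Cuboid.Touch C D → κ C ≠ κ D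

namespace Cuboid

/-- The `3 × 1 × 1` brick rooted at `(x, y, z)`. -/
def brick (x y z : ℤ) : Cuboid := ⟨(x, y, z), (3, 1, 1)⟩

theorem Collide.root_close {C D : Cuboid} (hC : C.dims = (3, 1, 1)) (hD : D.dims = (3, 1, 1))
    (h : Collide C D) :
    |C.root.1 - D.root.1| < 3 ∧ C.root.2.1 = D.root.2.1 ∧ C.root.2.2 = D.root.2.2 := by
  obtain ⟨p, ⟨h1, h2, h3, h4, h5, h6⟩, h1', h2', h3', h4', h5', h6'⟩ := h
  simp only [hC, hD] at h2 h4 h6 h2' h4' h6'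
  have hx := h1.trans h2'
  have hx' := h1'.trans h2
  have hy := h3.trans h4'
  have hy' := h3'.trans h4
  have hz := h5.trans h6'
  have hz' := h5'.trans h6
  norm_cast at hx hx' hy hy' hz hz'
  refine ⟨?_, ?_, ?_⟩
  · rw [abs_lt]
    omega
  · omega
  · omega

theorem intCast_add_half_ne (n m : ℤ) : (n : ℝ) + 1 / 2 ≠ m := by
  intro h
  have h' : 2 * n + 1 = 2 * m := by
    have : 2 * (n : ℝ) + 1 = 2 * m := by linarith
    exact_mod_cast this
  omega

theorem touch_brick_add_three (x y z : ℤ) : Touch (brick x y z) (brick (x + 3) y z) := by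
  refine ⟨fun h => ?_, ((x + 3 : ℝ), (y : ℝ) + 1 / 2, (z : ℝ) + 1 / 2), ⟨?_, ?_⟩, ?_⟩
  · simpa [brick] using (h.root_close rfl rfl).1
  · simp only [brick, toSet, Set.mem_ofPred_eq]
    push_cast
    refine ⟨?_, ?_, ?_, ?_, ?_, ?_⟩ <;> linarith
  · simp only [brick, toSet, Set.mem_ofPred_eq]
    push_cast
    refine ⟨?_, ?_, ?_, ?_, ?_, ?_⟩ <;> linarith
  · rintro (⟨-, m, h⟩ | ⟨-, m, h⟩ | ⟨-, m, h⟩) <;> exact intCast_add_half_ne _ _ h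

theorem touch_brick_succ_snd {x x' : ℤ} (y z : ℤ) (h : |x - x'| < 3) :
    Touch (brick x y z) (brick x' (y + 1) z) := by
  obtain ⟨hl, hr⟩ := abs_lt.1 h
  have h₁ : max x x' + 1 ≤ x + 3 := by omega
  have h₂ : max x x' + 1 ≤ x' + 3 := by omega
  have h₃ : x ≤ max x x' := le_max_left _ _
  have h₄ : x' ≤ max x x' := le_max_right _ _
  generalize max x x' = w at h₁ h₂ h₃ h₄
  have h₁ : (w : ℝ) + 1 ≤ x + 3 := by exact_mod_cast h₁
  have h₂ : (w : ℝ) + 1 ≤ x' + 3 := by exact_mod_cast h₂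
  have h₃ : (x : ℝ) ≤ w := by exact_mod_cast h₃
  have h₄ : (x' : ℝ) ≤ w := by exact_mod_cast h₄
  refine ⟨fun h => ?_, ((w : ℝ) + 1 / 2, (y : ℝ) + 1, (z : ℝ) + 1 / 2), ⟨?_, ?_⟩, ?_⟩
  · simpa [brick] using (h.root_close rfl rfl).2.1
  · simp only [brick, toSet, Set.mem_ofPred_eq]
    push_cast
    refine ⟨?_, ?_, ?_, ?_, ?_, ?_⟩ <;> linarith
  · simp only [brick, toSet, Set.mem_ofPred_eq]
    push_cast
    refine ⟨?_, ?_, ?_, ?_, ?_, ?_⟩ <;> linarith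
  · rintro (⟨⟨m, h⟩, -⟩ | ⟨⟨m, h⟩, -⟩ | ⟨-, m, h⟩) <;> exact intCast_add_half_ne _ _ h

theorem touch_brick_succ_trd {x x' : ℤ} (y z : ℤ) (h : |x - x'| < 3) :
    Touch (brick x y z) (brick x' y (z + 1)) := by
  obtain ⟨hl, hr⟩ := abs_lt.1 h
  have h₁ : max x x' + 1 ≤ x + 3 := by omega
  have h₂ : max x x' + 1 ≤ x' + 3 := by omega
  have h₃ : x ≤ max x x' := le_max_left _ _
  have h₄ : x' ≤ max x x' := le_max_right _ _
  generalize max x x' = w at h₁ h₂ h₃ h₄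
  have h₁ : (w : ℝ) + 1 ≤ x + 3 := by exact_mod_cast h₁
  have h₂ : (w : ℝ) + 1 ≤ x' + 3 := by exact_mod_cast h₂
  have h₃ : (x : ℝ) ≤ w := by exact_mod_cast h₃
  have h₄ : (x' : ℝ) ≤ w := by exact_mod_cast h₄
  refine ⟨fun h => ?_, ((w : ℝ) + 1 / 2, (y : ℝ) + 1 / 2, (z : ℝ) + 1), ⟨?_, ?_⟩, ?_⟩
  · simpa [brick] using (h.root_close rfl rfl).2.2
  · simp only [brick, toSet, Set.mem_ofPred_eq]
    push_cast
    refine ⟨?_, ?_, ?_, ?_, ?_, ?_⟩ <;> linarith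
  · simp only [brick, toSet, Set.mem_ofPred_eq]
    push_cast
    refine ⟨?_, ?_, ?_, ?_, ?_, ?_⟩ <;> linarith
  · rintro (⟨⟨m, h⟩, -⟩ | ⟨⟨m, h⟩, -⟩ | ⟨⟨m, h⟩, -⟩) <;> exact intCast_add_half_ne _ _ h

/-- Ten bricks, three pairs of which share two mutually touching neighbours. -/
def spindle : Finset Cuboid :=
  {brick 3 0 0, brick 2 0 1, brick 5 0 1, brick 1 1 0, brick 4 1 0, brick 1 1 1, brick 4 1 1,
    brick 2 2 0, brick 0 2 1, brick 3 2 1}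

theorem dims_of_mem_spindle : ∀ C ∈ spindle, C.dims = (3, 1, 1) := by decide

theorem eq_of_mem_spindle_of_root_close : ∀ C ∈ spindle, ∀ D ∈ spindle,
    |C.root.1 - D.root.1| < 3 ∧ C.root.2.1 = D.root.2.1 ∧ C.root.2.2 = D.root.2.2 → C = D := by
  decide

/-- In a 3-coloring, two common neighbours of an edge have the same color. -/
theorem eq_of_ne_of_ne_fin_three {a b c d : Fin 3} (hbc : b ≠ c) (hab : a ≠ b) (hac : a ≠ c)
    (hdb : d ≠ b) (hdc : d ≠ c) : a = d := by
  omega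

theorem not_properColoring_spindle : ¬ ProperColoring 3 spindle := by
  rintro ⟨κ, hκ⟩
  have hfst (x y z : ℤ) (h : brick x y z ∈ spindle) (h' : brick (x + 3) y z ∈ spindle) :
      κ (brick x y z) ≠ κ (brick (x + 3) y z) := hκ _ h _ h' (touch_brick_add_three x y z)
  have hsnd (x x' y z : ℤ) (h : brick x y z ∈ spindle) (h' : brick x' (y + 1) z ∈ spindle)
      (hx : |x - x'| < 3) : κ (brick x y z) ≠ κ (brick x' (y + 1) z) :=
    hκ _ h _ h' (touch_brick_succ_snd y z hx)
  have htrd (x x' y z : ℤ) (h : brick x y z ∈ spindle) (h' : brick x' y (z + 1) ∈ spindle)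
      (hx : |x - x'| < 3) : κ (brick x y z) ≠ κ (brick x' y (z + 1)) :=
    hκ _ h _ h' (touch_brick_succ_trd y z hx)
  have h₁ : κ (brick 2 2 0) = κ (brick 3 0 0) := eq_of_ne_of_ne_fin_three
    (hfst 1 1 0 (by decide) (by decide))
    (hsnd 1 2 1 0 (by decide) (by decide) (by decide)).symm
    (hsnd 4 2 1 0 (by decide) (by decide) (by decide)).symm
    (hsnd 3 1 0 0 (by decide) (by decide) (by decide))
    (hsnd 3 4 0 0 (by decide) (by decide) (by decide))
  have h₂ : κ (brick 3 0 0) = κ (brick 4 1 1) := eq_of_ne_of_ne_fin_three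
    (hfst 2 0 1 (by decide) (by decide))
    (htrd 3 2 0 0 (by decide) (by decide) (by decide))
    (htrd 3 5 0 0 (by decide) (by decide) (by decide))
    (hsnd 2 4 0 1 (by decide) (by decide) (by decide)).symm
    (hsnd 5 4 0 1 (by decide) (by decide) (by decide)).symm
  have h₃ : κ (brick 4 1 1) = κ (brick 0 2 1) := eq_of_ne_of_ne_fin_three
    (hsnd 1 3 1 1 (by decide) (by decide) (by decide))
    (hfst 1 1 1 (by decide) (by decide)).symm
    (hsnd 4 3 1 1 (by decide) (by decide) (by decide))
    (hsnd 1 0 1 1 (by decide) (by decide) (by decide)).symm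
    (hfst 0 2 1 (by decide) (by decide))
  exact htrd 2 0 2 0 (by decide) (by decide) (by decide) (h₁.trans (h₂.trans h₃))

end Cuboid

/-- There is a type-1 configuration of `[3,1,1]` with no proper 3-coloring. -/
theorem exists_type1_311_not_3colorable :
    ∃ F : Finset Cuboid, IsConfig F ∧ Type1 3 1 1 F ∧ ¬ ProperColoring 3 F := by
  refine ⟨Cuboid.spindle, ⟨fun C hC => ?_, fun C hC D hD hne h => hne ?_⟩,
    Cuboid.dims_of_mem_spindle, Cuboid.not_properColoring_spindle⟩
  · simp [Cuboid.valid, Cuboid.dims_of_mem_spindle C hC]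
  · exact Cuboid.eq_of_mem_spindle_of_root_close C hC D hD
      (h.root_close (Cuboid.dims_of_mem_spindle C hC) (Cuboid.dims_of_mem_spindle D hD))
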